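/- Suppose the system is highly non-singular, let 𝒜 be either ℤ ∩ [1,P] or 𝒜(P,R) with 2 ≤ R ≤ P, set s_0 = Σ_{h=1}^{t} (μ_h − μ_{h+1}) u_h, and suppose that for each 1 ≤ h ≤ t and each ε > 0 there is a constant C(h,ε) with J_{u_h, 𝐤_h}(𝒜) ≤ C(h,ε) P^{2u_h − (K_1 + … + K_h) + ε} for all P ≥ 1. Then for every ε > 0 there is a constant C(ε) such that |I_{𝐮,𝐤,𝛍}(𝒜)| ≤ C(ε) P^{2s_0 − K + ε} for all P ≥ 1, where K = d_1 + … + d_r. -/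

import Mathlib

open MeasureTheory Filter Finset
open scoped Classical

noncomputable section

/-- `e(θ) = exp(2πiθ)`. -/
def eC (θ : ℝ) : ℂ := Complex.exp (2 * Real.pi * Complex.I * θ)

/-- Index pairs `(l, n)` for the distinct exponents `k_{l,n}`. -/
abbrev KIdx (t : ℕ) (ν : Fin t → ℕ) := Σ l : Fin t, Fin (ν l)

/-- Equation indices `(l, n, m)`: the `μ_l` equations of exponent `k_{l,n}`
(the interval `𝓘_{l,n}`). -/
abbrev EqIdx (t : ℕ) (ν μ : Fin t → ℕ) := Σ l : Fin t, Fin (ν l) × Fin (μ l)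

variable (t : ℕ) (ν μ : Fin t → ℕ) (k : (l : Fin t) → Fin (ν l) → ℕ)

/-- The degree `d_i` of equation `i`. -/
def deg (i : EqIdx t ν μ) : ℕ := k i.1 i.2.1

/-- `μ_h` for `1 ≤ h ≤ t` (`1`-based), with the convention `μ_{t+1} = 0`. -/
def mu1 (h : ℕ) : ℕ := if hh : 1 ≤ h ∧ h ≤ t then μ ⟨h - 1, by omega⟩ else 0

/-- `ϖ_h = ν(1) + ⋯ + ν(h)`. -/
def varpi (h : ℕ) : ℕ := ∑ l : Fin t, if (l : ℕ) < h then ν l else 0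

/-- `K_1 + ⋯ + K_h`. -/
def Ksum (h : ℕ) : ℕ := ∑ p : KIdx t ν, if (p.1 : ℕ) < h then k p.1 p.2 else 0

/-- The largest degree `k`. -/
def kmax : ℕ := Finset.univ.sup fun p : KIdx t ν => k p.1 p.2

/-- The total degree `K = d_1 + ⋯ + d_r`. -/
def Ktot : ℕ := ∑ i : EqIdx t ν μ, deg t ν μ k i

/-- The grouping hypotheses: `t ≥ 1`, all `ν l ≥ 1`, the multiplicities are
positive and strictly decreasing `μ_1 > ⋯ > μ_t`, and the exponents `k_{l,n}`
are positive and pairwise distinct. -/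
def GroupedDegrees : Prop :=
  0 < t ∧ (∀ l, 0 < ν l) ∧ (∀ l, 0 < μ l) ∧ StrictAnti μ ∧
    (∀ l n, 0 < k l n) ∧ Function.Injective fun p : KIdx t ν => k p.1 p.2

/-- `ℤ ∩ [1, P]` as a finite set. -/
def completeFS (P : ℝ) : Finset ℕ := Finset.Icc 1 ⌊P⌋₊

/-- `𝒜(P,R)`: the `R`-smooth numbers up to `P`. -/
def smoothFS (P R : ℝ) : Finset ℕ :=
  (Finset.Icc 1 ⌊P⌋₊).filter fun n => ∀ p : ℕ, p.Prime → p ∣ n → (p : ℝ) ≤ R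

/-- The exponential sum `f_{𝐤_h}(γ; 𝒜) = Σ_{x ∈ 𝒜} e(Σ_{l ≤ h, n} γ_{l,n} x^{k_{l,n}})`. -/
def fA (A : Finset ℕ) (h : ℕ) (γ : KIdx t ν → ℝ) : ℂ :=
  ∑ x ∈ A, eC (∑ p : KIdx t ν, if (p.1 : ℕ) < h then γ p * (x : ℝ) ^ (k p.1 p.2) else 0)

/-- The mean value `J_{u,𝐤_h}(𝒜)` (the coordinates `γ_{l,n}` with `l > h` are
dummy variables over the probability box, so this agrees with the
`ϖ_h`-dimensional integral). -/
def JA (A : Finset ℕ) (u h : ℕ) : ℝ :=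
  ∫ γ in Set.univ.pi fun _ : KIdx t ν => Set.Ico (0 : ℝ) 1, ‖fA t ν k A h γ‖ ^ (2 * u)

variable (s : ℕ) (c : EqIdx t ν μ → Fin s → ℤ)

/-- The system `Σ_j c_{ij} x_j^{d_i} = 0` is highly non-singular: all coefficients
are nonzero and every `μ_l × μ_l` minor taken from the rows `𝓘_{l,n}` is nonzero. -/
def HighlyNonSingular : Prop :=
  (∀ i j, c i j ≠ 0) ∧
  ∀ (l : Fin t) (n : Fin (ν l)) (J : Fin (μ l) → Fin s), Function.Injective J →
    (Matrix.of fun m m' : Fin (μ l) => c ⟨l, (n, m)⟩ (J m')).det ≠ 0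

/-- `x` is a solution of the system, with coordinates in a commutative ring. -/
def IsSol {A : Type*} [CommRing A] (x : Fin s → A) : Prop :=
  ∀ i, ∑ j, (c i j : A) * x j ^ deg t ν μ k i = 0

/-- The Jacobian `(d_i c_{ij} x_j^{d_i - 1})` has full rank `r` at `x`. -/
def JacFullRank {A : Type*} [CommRing A] (x : Fin s → A) : Prop :=
  (Matrix.of fun (i : EqIdx t ν μ) (j : Fin s) =>
      (deg t ν μ k i : A) * (c i j : A) * x j ^ (deg t ν μ k i - 1)).rank
    = Fintype.card (EqIdx t ν μ)

/-- The generalized exponential sum `f_j(α; 𝒜) = Σ_{x ∈ 𝒜} e(Σ_{l,n} γ_{j,l,n} x^{k_{l,n}})`,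
where `γ_{j,l,n} = Σ_{i ∈ 𝓘_{l,n}} c_{ij} α_i`. -/
def fj (A : Finset ℕ) (α : EqIdx t ν μ → ℝ) (j : Fin s) : ℂ :=
  ∑ x ∈ A, eC (∑ i : EqIdx t ν μ, (c i j : ℝ) * α i * (x : ℝ) ^ deg t ν μ k i)

end

noncomputable section

/-- The mean value `I_{𝐮,𝐤,𝛍}(𝒜)`. -/
def Iint (t : ℕ) (ν μ : Fin t → ℕ) (k : (l : Fin t) → Fin (ν l) → ℕ) (s : ℕ)
    (c : EqIdx t ν μ → Fin s → ℤ) (A : Finset ℕ) (B : ℕ × ℕ → Finset (Fin s)) : ℂ :=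
  ∫ α in Set.univ.pi fun _ : EqIdx t ν μ => Set.Ico (0 : ℝ) 1,
    ∏ h ∈ Finset.Icc 1 t, ∏ m ∈ Finset.Icc 1 (mu1 t μ h - mu1 t μ (h + 1)),
      ∏ j ∈ B (h, m), fj t ν μ k s c A α j

section ExponentialSums

theorem eC_zero : eC 0 = 1 := by simp [eC]

theorem eC_add (x y : ℝ) : eC (x + y) = eC x * eC y := by
  simp only [eC, ← Complex.exp_add]
  congr 1
  push_cast
  ring

theorem norm_eC (x : ℝ) : ‖eC x‖ = 1 := by
  have h : (2 * Real.pi * Complex.I * x : ℂ) = ((2 * Real.pi * x : ℝ) : ℂ) * Complex.I := by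
    push_cast
    ring
  rw [eC, h, Complex.norm_exp_ofReal_mul_I]

theorem conj_eC (x : ℝ) : (starRingEnd ℂ) (eC x) = eC (-x) := by
  simp only [eC, ← Complex.exp_conj]
  congr 1
  simp [map_ofNat]

theorem continuous_eC : Continuous eC := by
  unfold eC
  fun_prop

theorem integral_eC_int_mul (n : ℤ) :
    ∫ x in Set.Ico (0 : ℝ) 1, eC (n * x) = if n = 0 then 1 else 0 := by
  rw [integral_Ico_eq_integral_Ioc, ← intervalIntegral.integral_of_le zero_le_one]
  split_ifs with h
  · simp [h, eC_zero]
  · have hc : (2 * Real.pi * Complex.I * n : ℂ) ≠ 0 := by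
      simp [h, Real.pi_ne_zero]
    have h1 : ∀ x : ℝ, eC (n * x) = Complex.exp ((2 * Real.pi * Complex.I * n) * x) := by
      intro x
      simp only [eC]
      congr 1
      push_cast
      ring
    simp only [h1]
    rw [integral_exp_mul_complex hc]
    have h2 : (2 * Real.pi * Complex.I * n * ((1 : ℝ) : ℂ) : ℂ)
        = n * (2 * Real.pi * Complex.I) := by
      push_cast
      ring
    rw [h2, Complex.exp_int_mul_two_pi_mul_I]
    simp

variable {ι : Type*} [Fintype ι]

/-- The half-open unit box `[0,1)^ι`. -/
abbrev unitBox (ι : Type*) : Set (ι → ℝ) := Set.univ.pi fun _ : ι => Set.Ico (0 : ℝ) 1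

/-- The character `α ↦ e(n · α)`. -/
def chr (α : ι → ℝ) (n : ι → ℤ) : ℂ := eC (∑ i, (n i : ℝ) * α i)

theorem chr_zero (α : ι → ℝ) : chr α 0 = 1 := by simp [chr, eC_zero]

theorem chr_add (α : ι → ℝ) (m n : ι → ℤ) : chr α (m + n) = chr α m * chr α n := by
  simp [chr, ← eC_add, add_mul, Finset.sum_add_distrib]

theorem conj_chr (α : ι → ℝ) (n : ι → ℤ) : (starRingEnd ℂ) (chr α n) = chr α (-n) := by
  simp [chr, conj_eC]

theorem norm_chr (α : ι → ℝ) (n : ι → ℤ) : ‖chr α n‖ = 1 := norm_eC _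

theorem chr_sum {κ : Type*} (S : Finset κ) (α : ι → ℝ) (n : κ → ι → ℤ) :
    chr α (∑ b ∈ S, n b) = ∏ b ∈ S, chr α (n b) := by
  induction S using Finset.induction_on with
  | empty => simp [chr_zero]
  | insert a S ha ih => rw [Finset.sum_insert ha, Finset.prod_insert ha, chr_add, ih]

@[fun_prop]
theorem continuous_chr (n : ι → ℤ) : Continuous fun α : ι → ℝ => chr α n :=
  continuous_eC.comp (by fun_prop)

theorem Continuous.integrableOn_unitBox {E : Type*} [NormedAddCommGroup E]
    {g : (ι → ℝ) → E} (hg : Continuous g) : IntegrableOn g (unitBox ι) :=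
  (hg.continuousOn.integrableOn_compact
    (isCompact_univ_pi fun _ : ι => isCompact_Icc (a := (0 : ℝ)) (b := 1))).mono_set
      (Set.pi_mono fun _ _ => Set.Ico_subset_Icc_self)

theorem integral_chr (n : ι → ℤ) :
    ∫ α in unitBox ι, chr α n = if n = 0 then 1 else 0 := by
  have h : ∀ α : ι → ℝ, chr α n = ∏ i, eC (n i * α i) := by
    intro α
    have hs : ∀ S : Finset ι, eC (∑ i ∈ S, (n i : ℝ) * α i) = ∏ i ∈ S, eC (n i * α i) := by
      intro S
      induction S using Finset.induction_on with
      | empty => simp [eC_zero]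
      | insert a S ha ih => rw [Finset.sum_insert ha, Finset.prod_insert ha, eC_add, ih]
    exact hs _
  simp only [h]
  rw [volume_pi, Measure.restrict_pi_pi,
    integral_fintype_prod_eq_prod (fun i (x : ℝ) => eC (n i * x))]
  simp only [integral_eC_int_mul, Finset.prod_ite_zero, Finset.prod_const_one, funext_iff,
    Finset.mem_univ, true_imp_iff, Pi.zero_apply]

theorem integral_sum_chr {ζ : Type*} (Z : Finset ζ) (φ : ζ → ι → ℤ) :
    ∫ α in unitBox ι, ∑ z ∈ Z, chr α (φ z) = ((Z.filter fun z => φ z = 0).card : ℂ) := by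
  rw [integral_finsetSum]
  · simp only [integral_chr, Finset.sum_ite, Finset.sum_const_zero, Finset.sum_const]
    simp
  · exact fun z _ => (continuous_chr _).integrableOn_unitBox

/-- The difference of two sums of `u` values of `g`. -/
def signedSum {ξ M : Type*} [AddCommGroup M] {u : ℕ} (g : ξ → M) (z : Fin u ⊕ Fin u → ξ) : M :=
  ∑ a, g (z (Sum.inl a)) - ∑ a, g (z (Sum.inr a))

theorem signedSum_apply {ξ κ M : Type*} [AddCommGroup M] {u : ℕ} (g : ξ → κ → M)
    (z : Fin u ⊕ Fin u → ξ) (i : κ) : signedSum g z i = signedSum (fun x => g x i) z := by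
  simp [signedSum]

theorem signedSum_mul_left {ξ M : Type*} [Ring M] {u : ℕ} (a : M) (g : ξ → M)
    (z : Fin u ⊕ Fin u → ξ) : signedSum (fun x => a * g x) z = a * signedSum g z := by
  simp [signedSum, mul_sub, Finset.mul_sum]

theorem norm_sum_chr_pow {ξ : Type*} (A : Finset ξ) (u : ℕ) (φ : ξ → ι → ℤ) (α : ι → ℝ) :
    ((‖∑ x ∈ A, chr α (φ x)‖ ^ (2 * u) : ℝ) : ℂ)
      = ∑ z ∈ Fintype.piFinset fun _ : Fin u ⊕ Fin u => A, chr α (signedSum φ z) := by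
  set F : ℂ := ∑ x ∈ A, chr α (φ x) with hF
  have hconj : (starRingEnd ℂ) F = ∑ x ∈ A, chr α (-φ x) := by
    simp only [hF, map_sum, conj_chr]
  have h1 : ((‖F‖ ^ (2 * u) : ℝ) : ℂ) = F ^ u * (starRingEnd ℂ) F ^ u := by
    rw [← mul_pow, Complex.mul_conj, Complex.normSq_eq_norm_sq, pow_mul]
    push_cast
    rfl
  have h2 : ∏ a : Fin u ⊕ Fin u, ∑ x ∈ A,
      chr α (Sum.elim (fun _ => φ x) (fun _ => -φ x) a)
        = F ^ u * (starRingEnd ℂ) F ^ u := by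
    rw [Fintype.prod_sum_type]
    simp only [Sum.elim_inl, Sum.elim_inr, ← hF, ← hconj, Finset.prod_const, Finset.card_univ,
      Fintype.card_fin]
  rw [h1, ← h2, Finset.prod_univ_sum]
  refine Finset.sum_congr rfl fun z _ => ?_
  rw [← chr_sum, Fintype.sum_sum_type]
  simp [signedSum, sub_eq_add_neg]

theorem integral_prod_norm_sum_chr_pow {ξ β : Type*} [Fintype β] (A : Finset ξ) (u : β → ℕ)
    (φ : β → ξ → ι → ℤ) :
    ∫ α in unitBox ι, ∏ b, ‖∑ x ∈ A, chr α (φ b x)‖ ^ (2 * u b)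
      = (((Fintype.piFinset fun b => Fintype.piFinset fun _ : Fin (u b) ⊕ Fin (u b) => A).filter
          fun z => ∑ b, signedSum (φ b) (z b) = 0).card : ℝ) := by
  have h := integral_sum_chr
    (Fintype.piFinset fun b => Fintype.piFinset fun _ : Fin (u b) ⊕ Fin (u b) => A)
    (fun z => ∑ b, signedSum (φ b) (z b))
  rw [← Complex.ofReal_inj, ← integral_complex_ofReal, Complex.ofReal_natCast, ← h]
  refine integral_congr_ae (Eventually.of_forall fun α => ?_)
  simp only [chr_sum]
  rw [← Finset.prod_univ_sum
    (fun b => Fintype.piFinset fun _ : Fin (u b) ⊕ Fin (u b) => A)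
    (fun b z => chr α (signedSum (φ b) z)), Complex.ofReal_prod]
  exact Finset.prod_congr rfl fun b _ => norm_sum_chr_pow A (u b) (φ b) α

/-- Shifting the right-hand side of a symmetric system does not increase the number of
solutions beyond the mean value. -/
theorem card_signedSum_eq_le {ξ : Type*} (A : Finset ξ) (u : ℕ) (φ : ξ → ι → ℤ) (v : ι → ℤ) :
    (((Fintype.piFinset fun _ : Fin u ⊕ Fin u => A).filter fun z => signedSum φ z = v).card : ℝ)
      ≤ ∫ α in unitBox ι, ‖∑ x ∈ A, chr α (φ x)‖ ^ (2 * u) := by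
  have h := integral_sum_chr (Fintype.piFinset fun _ : Fin u ⊕ Fin u => A)
    (fun z => signedSum φ z + -v)
  simp only [chr_add, ← Finset.sum_mul, ← norm_sum_chr_pow, add_neg_eq_zero] at h
  rw [← Complex.norm_natCast, ← h]
  refine (norm_integral_le_integral_norm _).trans_eq ?_
  refine integral_congr_ae (Eventually.of_forall fun α => ?_)
  simp [norm_chr]

end ExponentialSums

section Counting

/-- If, on a finite set `Z` of tuples, the coordinates of smaller rank determine `F b (z b)`, and
each `F b` has fibres of size at most `M b`, then `Z` has at most `∏ b, M b` elements. -/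
theorem card_le_prod_of_determined {β V : Type*} [Fintype β] [DecidableEq V] {X : β → Type*}
    (Z : Finset (∀ b, X b)) (Y : ∀ b, Finset (X b)) (hZ : ∀ z ∈ Z, ∀ b, z b ∈ Y b)
    (r : β → ℕ) (F : ∀ b, X b → V) (M : β → ℕ)
    (hM : ∀ b v, ((Y b).filter fun x => F b x = v).card ≤ M b)
    (hF : ∀ b, ∀ z ∈ Z, ∀ z' ∈ Z, (∀ b', r b' < r b → z b' = z' b') → F b (z b) = F b (z' b)) :
    Z.card ≤ ∏ b, M b := by
  have key : ∀ S : Finset β,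
      (∀ b ∈ S, ∀ b', r b' < r b → b' ∈ S) →
      (Z.image S.restrict).card ≤ ∏ b ∈ S, M b := by
    intro S
    induction S using Finset.induction_on_max_value r with
    | empty =>
      intro _
      simpa using Finset.card_le_one_of_subsingleton (Z.image (Finset.restrict (π := X) ∅))
    | insert a S ha hmax ih =>
      intro hS
      have hS' : ∀ b ∈ S, ∀ b', r b' < r b → b' ∈ S := by
        intro b hb b' hb'
        rcases Finset.mem_insert.1 (hS b (Finset.mem_insert_of_mem hb) b' hb') with h | h
        · subst h
          exact absurd (hmax b hb) (by omega)
        · exact h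
      rw [Finset.prod_insert ha]
      have himg : (Z.image (insert a S).restrict).image
          (Finset.restrict₂ (π := X) (Finset.subset_insert a S)) = Z.image S.restrict := by
        rw [Finset.image_image]
        rfl
      refine (Finset.card_le_mul_card_image
        (f := Finset.restrict₂ (π := X) (Finset.subset_insert a S)) _ (M a) ?_).trans ?_
      · intro w hw
        rw [himg] at hw
        obtain ⟨z₀, hz₀, rfl⟩ := Finset.mem_image.1 hw
        refine le_trans ?_ (hM a (F a (z₀ a)))
        refine Finset.card_le_card_of_injOn
          (fun y => y ⟨a, Finset.mem_insert_self a S⟩) ?_ ?_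
        · intro y hy
          obtain ⟨hy1, hy2⟩ := Finset.mem_filter.1 hy
          obtain ⟨z, hz, rfl⟩ := Finset.mem_image.1 hy1
          have hagree : ∀ b ∈ S, z b = z₀ b := fun b hb => congrFun hy2 ⟨b, hb⟩
          refine Finset.mem_filter.2 ⟨hZ z hz a, hF a z hz z₀ hz₀ fun b' hb' => hagree b' ?_⟩
          rcases Finset.mem_insert.1 (hS a (Finset.mem_insert_self a S) b' hb') with h | h
          · exact absurd hb' (by rw [h]; omega)
          · exact h
        · intro y hy y' hy' hyy
          have h2 := (Finset.mem_filter.1 hy).2.trans (Finset.mem_filter.1 hy').2.symm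
          funext ⟨b, hb⟩
          rcases Finset.mem_insert.1 hb with h | h
          · subst h
            exact hyy
          · exact congrFun h2 ⟨b, h⟩
      · rw [himg]
        exact Nat.mul_le_mul_left _ (ih hS')
  refine le_trans (le_of_eq ?_) (key Finset.univ fun _ _ _ _ => Finset.mem_univ _)
  refine (Finset.card_image_of_injective Z fun z z' h => ?_).symm
  funext b
  exact congrFun h ⟨b, Finset.mem_univ b⟩

theorem prod_le_sum_pow_card {κ : Type*} (S : Finset κ) (hS : S.Nonempty) (g : κ → ℝ)
    (hg : ∀ j, 0 ≤ g j) : ∏ j ∈ S, g j ≤ ∑ j ∈ S, g j ^ S.card := by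
  obtain ⟨j₀, hj₀, hmax⟩ := S.exists_max_image g hS
  calc ∏ j ∈ S, g j ≤ ∏ _j ∈ S, g j₀ := Finset.prod_le_prod (fun j _ => hg j) hmax
    _ = g j₀ ^ S.card := by simp
    _ ≤ _ := Finset.single_le_sum (f := fun j => g j ^ S.card)
        (fun j _ => pow_nonneg (hg j) _) hj₀

end Counting

section MeanValue

variable {t : ℕ} {ν μ : Fin t → ℕ} {k : (l : Fin t) → Fin (ν l) → ℕ} {s : ℕ}
  {c : EqIdx t ν μ → Fin s → ℤ}

theorem fj_eq_sum_chr (A : Finset ℕ) (α : EqIdx t ν μ → ℝ) (j : Fin s) :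
    fj t ν μ k s c A α j = ∑ x ∈ A, chr α (fun i => c i j * (x : ℤ) ^ deg t ν μ k i) := by
  refine Finset.sum_congr rfl fun x _ => ?_
  unfold chr
  congr 1
  refine Finset.sum_congr rfl fun i _ => ?_
  push_cast
  ring

theorem fA_eq_sum_chr (A : Finset ℕ) (h : ℕ) (γ : KIdx t ν → ℝ) :
    fA t ν k A h γ
      = ∑ x ∈ A, chr γ (fun p => if (p.1 : ℕ) < h then (x : ℤ) ^ k p.1 p.2 else 0) := by
  refine Finset.sum_congr rfl fun x _ => ?_
  unfold chr
  congr 1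
  refine Finset.sum_congr rfl fun p _ => ?_
  by_cases hp : (p.1 : ℕ) < h
  · simp only [if_pos hp]
    push_cast
    ring
  · simp only [if_neg hp]
    simp

theorem JA_nonneg (A : Finset ℕ) (u h : ℕ) : 0 ≤ JA t ν k A u h :=
  integral_nonneg fun _ => by positivity

/-- The symmetric mean value with one variable block for each `b` is bounded by the product of
the mean values `J`, provided exactly `μ_l` blocks have level at least `l`. -/
theorem integral_prod_norm_fj_pow_le (hns : HighlyNonSingular t ν μ s c)
    {β : Type*} [Fintype β] (u lev : β → ℕ) (j : β → Fin s) (hj : Function.Injective j)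
    (hcard : ∀ l : Fin t, Fintype.card {b // (l : ℕ) < lev b} = μ l) (A : Finset ℕ) :
    ∫ α in unitBox (EqIdx t ν μ), ∏ b, ‖fj t ν μ k s c A α (j b)‖ ^ (2 * u b)
      ≤ ∏ b, JA t ν k A (u b) (lev b) := by
  simp only [fj_eq_sum_chr]
  rw [integral_prod_norm_sum_chr_pow A u
    (fun b x i => c i (j b) * (x : ℤ) ^ deg t ν μ k i)]
  set Z := (Fintype.piFinset fun b =>
    Fintype.piFinset fun _ : Fin (u b) ⊕ Fin (u b) => A).filter fun z =>
      ∑ b, signedSum (fun (x : ℕ) i => c i (j b) * (x : ℤ) ^ deg t ν μ k i) (z b) = 0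
  have hZA : ∀ z ∈ Z, ∀ b, z b ∈ Fintype.piFinset fun _ : Fin (u b) ⊕ Fin (u b) => A :=
    fun z hz => Fintype.mem_piFinset.1 (Finset.mem_filter.1 hz).1
  have hZ0 : ∀ z ∈ Z, ∀ i,
      ∑ b, c i (j b) * signedSum (fun x : ℕ => (x : ℤ) ^ deg t ν μ k i) (z b) = 0 := by
    intro z hz i
    have h := congrFun (Finset.mem_filter.1 hz).2 i
    simpa only [Finset.sum_apply, signedSum_apply, signedSum_mul_left, Pi.zero_apply] using h
  clear_value Z
  have hle : Z.card ≤ ∏ b, ⌊JA t ν k A (u b) (lev b)⌋₊ := by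
    refine card_le_prod_of_determined Z _ hZA lev
      (fun b => signedSum fun (x : ℕ) (p : KIdx t ν) =>
        if (p.1 : ℕ) < lev b then (x : ℤ) ^ k p.1 p.2 else 0) _ ?_ ?_
    · intro b v
      refine Nat.le_floor ((card_signedSum_eq_le A (u b) _ v).trans_eq ?_)
      simp only [JA, fA_eq_sum_chr]
    · intro b z hz z' hz' hagree
      funext p
      rw [signedSum_apply, signedSum_apply]
      by_cases hp : (p.1 : ℕ) < lev b
      swap
      · simp [hp, signedSum]
      simp only [hp, if_true]
      obtain ⟨l, n⟩ := p
      let σ : (∀ b, Fin (u b) ⊕ Fin (u b) → ℕ) → β → ℤ :=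
        fun z b => signedSum (fun x : ℕ => (x : ℤ) ^ k l n) (z b)
      have hsol : ∀ y ∈ Z, ∀ m, ∑ b, c ⟨l, (n, m)⟩ (j b) * σ y b = 0 :=
        fun y hy m => hZ0 y hy ⟨l, (n, m)⟩
      let w : β → ℤ := fun b => σ z b - σ z' b
      have hw0 : ∀ b', ¬ (l : ℕ) < lev b' → w b' = 0 := by
        intro b' hb'
        have : z b' = z' b' := hagree b' (lt_of_le_of_lt (not_lt.1 hb') hp)
        simp [w, σ, this]
      let e : Fin (μ l) ≃ {b // (l : ℕ) < lev b} := (Fintype.equivFinOfCardEq (hcard l)).symm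
      have hdet := hns.2 l n (fun m => j (e m)) (hj.comp (Subtype.val_injective.comp e.injective))
      have hmul : (Matrix.of fun m m' : Fin (μ l) => c ⟨l, (n, m)⟩ (j (e m'))).mulVec
          (fun m => w (e m)) = 0 := by
        funext m
        have h1 : ∑ b, c ⟨l, (n, m)⟩ (j b) * w b = 0 := by
          simp only [w, mul_sub, Finset.sum_sub_distrib, hsol z hz m, hsol z' hz' m, sub_zero]
        have h2 : ∑ b : {b // (l : ℕ) < lev b}, c ⟨l, (n, m)⟩ (j b) * w b = 0 := by
          rw [← Finset.sum_subtype (Finset.univ.filter fun b => (l : ℕ) < lev b) (by simp)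
            (fun b => c ⟨l, (n, m)⟩ (j b) * w b), Finset.sum_filter_of_ne, h1]
          intro b _ hb
          by_contra hlt
          exact hb (by rw [hw0 b hlt, mul_zero])
        rw [← Equiv.sum_comp e] at h2
        exact h2
      have hzero := congrFun (Matrix.eq_zero_of_mulVec_eq_zero hdet hmul) (e.symm ⟨b, hp⟩)
      simp only [Equiv.apply_symm_apply, Pi.zero_apply] at hzero
      exact sub_eq_zero.1 hzero
  refine (Nat.cast_le.2 hle).trans ?_
  rw [Nat.cast_prod]
  exact Finset.prod_le_prod (fun _ _ => Nat.cast_nonneg _)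
    fun b _ => Nat.floor_le (JA_nonneg _ _ _)

theorem continuous_fj (A : Finset ℕ) (j : Fin s) :
    Continuous fun α => fj t ν μ k s c A α j := by
  simp only [fj_eq_sum_chr]
  fun_prop

/-- A mean value over disjoint blocks of variables is bounded, up to the number of ways of
choosing one variable from each block, by the product of the mean values `J`. -/
theorem norm_integral_prod_fj_le (hns : HighlyNonSingular t ν μ s c)
    {β : Type*} [Fintype β] (u lev : β → ℕ) (hu : ∀ b, 0 < u b) (B : β → Finset (Fin s))
    (hB : ∀ b, (B b).card = 2 * u b) (hdisj : ∀ b b', b ≠ b' → Disjoint (B b) (B b'))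
    (hcard : ∀ l : Fin t, Fintype.card {b // (l : ℕ) < lev b} = μ l) (A : Finset ℕ) :
    ‖∫ α in unitBox (EqIdx t ν μ), ∏ b, ∏ i ∈ B b, fj t ν μ k s c A α i‖
      ≤ (∏ b, (2 * u b) : ℕ) * ∏ b, JA t ν k A (u b) (lev b) := by
  have hpt : ∀ α, ‖∏ b, ∏ i ∈ B b, fj t ν μ k s c A α i‖
      ≤ ∑ j ∈ Fintype.piFinset B, ∏ b, ‖fj t ν μ k s c A α (j b)‖ ^ (2 * u b) := by
    intro α
    rw [← Finset.prod_univ_sum B fun b i => ‖fj t ν μ k s c A α i‖ ^ (2 * u b)]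
    simp only [norm_prod]
    refine Finset.prod_le_prod (fun _ _ => by positivity) fun b _ => ?_
    rw [← hB b]
    refine prod_le_sum_pow_card _ ?_ _ fun _ => norm_nonneg _
    rw [← Finset.card_pos, hB b]
    have := hu b
    omega
  have hint : ∀ j ∈ Fintype.piFinset B, IntegrableOn
      (fun α => ∏ b, ‖fj t ν μ k s c A α (j b)‖ ^ (2 * u b)) (unitBox (EqIdx t ν μ)) := by
    intro j _
    refine Continuous.integrableOn_unitBox ?_
    exact continuous_finsetProd _ fun b _ => (continuous_fj A (j b)).norm.pow _
  refine (norm_integral_le_of_norm_le (integrable_finsetSum _ hint)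
    (Eventually.of_forall hpt)).trans ?_
  have hchoices : ∏ b, (2 * u b) = (Fintype.piFinset B).card := by
    simp only [Fintype.card_piFinset, hB]
  rw [integral_finsetSum _ hint, hchoices, ← nsmul_eq_mul]
  refine Finset.sum_le_card_nsmul _ _ _ fun j hj => ?_
  refine integral_prod_norm_fj_pow_le hns u lev j (fun b b' hbb => ?_) hcard A
  by_contra hne
  have hmem := Fintype.mem_piFinset.1 hj
  exact Finset.disjoint_left.1 (hdisj b b' hne) (hmem b) (hbb ▸ hmem b')

end MeanValue

section Multiplicities

variable {t : ℕ} {μ : Fin t → ℕ}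

theorem mu1_succ (l : Fin t) : mu1 t μ (l + 1) = μ l := by
  have : 1 ≤ (l : ℕ) + 1 ∧ (l : ℕ) + 1 ≤ t := by omega
  simp [mu1, this]

theorem mu1_succ_le (hμ : StrictAnti μ) {h : ℕ} (hh : 1 ≤ h) : mu1 t μ (h + 1) ≤ mu1 t μ h := by
  by_cases ht : h + 1 ≤ t
  · have h1 : 1 ≤ h + 1 ∧ h + 1 ≤ t := by omega
    have h2 : 1 ≤ h ∧ h ≤ t := by omega
    simp only [mu1, h1, h2, and_self, dif_pos]
    refine hμ.antitone ?_
    rw [Fin.mk_le_mk]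
    omega
  · simp [mu1, ht]

/-- The index set of the blocks `B_{h,m}`. -/
abbrev blockIdx (t : ℕ) (μ : Fin t → ℕ) : Finset (Σ _ : ℕ, ℕ) :=
  (Finset.Icc 1 t).sigma fun h => Finset.Icc 1 (mu1 t μ h - mu1 t μ (h + 1))

theorem sum_mu1_sub (hμ : StrictAnti μ) (l : ℕ) (hl : l ≤ t) :
    ∑ h ∈ Finset.Icc 1 t, (if l < h then mu1 t μ h - mu1 t μ (h + 1) else 0)
      = mu1 t μ (l + 1) := by
  have hf : (Finset.Icc 1 t).filter (fun h => l < h) = Finset.Ico (l + 1) (t + 1) := by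
    ext h
    simp only [Finset.mem_filter, Finset.mem_Icc, Finset.mem_Ico]
    omega
  rw [← Finset.sum_filter, hf]
  induction hl using Nat.decreasingInduction with
  | self => simp [mu1]
  | of_succ n hn ih =>
    have hf' : (Finset.Icc 1 t).filter (fun h => n + 1 < h) = Finset.Ico (n + 1 + 1) (t + 1) := by
      ext h
      simp only [Finset.mem_filter, Finset.mem_Icc, Finset.mem_Ico]
      omega
    rw [Finset.sum_eq_sum_Ico_succ_bot (by omega), ih hf']
    have := mu1_succ_le hμ (h := n + 1) (by omega)
    omega

theorem sum_blockIdx {M : Type*} [AddCommMonoid M] (g : ℕ → M) :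
    ∑ b : blockIdx t μ, g b.1.1
      = ∑ h ∈ Finset.Icc 1 t, (mu1 t μ h - mu1 t μ (h + 1)) • g h := by
  rw [Finset.sum_coe_sort (blockIdx t μ) fun b => g b.1, Finset.sum_sigma]
  simp

theorem card_blockIdx_lt (hμ : StrictAnti μ) (l : Fin t) :
    Fintype.card {b : blockIdx t μ // (l : ℕ) < b.1.1} = μ l := by
  rw [Fintype.card_subtype, Finset.card_filter,
    sum_blockIdx fun h => if (l : ℕ) < h then 1 else 0, ← mu1_succ (μ := μ) l,
    ← sum_mu1_sub hμ l l.2.le]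
  simp

theorem sum_blockIdx_Ksum (hμ : StrictAnti μ) (ν : Fin t → ℕ) (k : (l : Fin t) → Fin (ν l) → ℕ) :
    ∑ b : blockIdx t μ, Ksum t ν k b.1.1 = Ktot t ν μ k := by
  unfold Ksum Ktot deg
  rw [Finset.sum_comm]
  simp only [← Finset.sum_filter, Finset.sum_const, ← Fintype.card_subtype,
    card_blockIdx_lt hμ, Fintype.sum_sigma, Fintype.sum_prod_type]
  simp

end Multiplicities

/-- Corollary 2.2 of Brandes–Parsell: if each
`J_{u_h,𝐤_h}(𝒜) ≪_ε P^{2u_h - (K_1+⋯+K_h) + ε}`, then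
`I_{𝐮,𝐤,𝛍}(𝒜) ≪_ε P^{2s₀ - K + ε}`, where `s₀ = Σ_h (μ_h - μ_{h+1}) u_h`
and `𝒜 = 𝒜(P)` is either `ℤ ∩ [1,P]` for all `P`, or `𝒜(P, R(P))` for all `P`. -/
theorem statement10
    (t : ℕ) (ν μ : Fin t → ℕ) (k : (l : Fin t) → Fin (ν l) → ℕ)
    (hgrp : GroupedDegrees t ν μ k)
    (s : ℕ) (c : EqIdx t ν μ → Fin s → ℤ)
    (hns : HighlyNonSingular t ν μ s c)
    (u : ℕ → ℕ) (hu : ∀ h ∈ Finset.Icc 1 t, 0 < u h)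
    (hs : 2 * ∑ h ∈ Finset.Icc 1 t, (mu1 t μ h - mu1 t μ (h + 1)) * u h ≤ s)
    (B : ℕ × ℕ → Finset (Fin s))
    (hBcard : ∀ h ∈ Finset.Icc 1 t, ∀ m ∈ Finset.Icc 1 (mu1 t μ h - mu1 t μ (h + 1)),
      (B (h, m)).card = 2 * u h)
    (hBdisj : ∀ h ∈ Finset.Icc 1 t, ∀ m ∈ Finset.Icc 1 (mu1 t μ h - mu1 t μ (h + 1)),
      ∀ h' ∈ Finset.Icc 1 t, ∀ m' ∈ Finset.Icc 1 (mu1 t μ h' - mu1 t μ (h' + 1)),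
        (h, m) ≠ (h', m') → Disjoint (B (h, m)) (B (h', m')))
    (A : ℝ → Finset ℕ)
    (hA : (∀ P : ℝ, A P = completeFS P) ∨
      ∃ R : ℝ → ℝ, (∀ P : ℝ, 2 ≤ P → 2 ≤ R P ∧ R P ≤ P) ∧ ∀ P : ℝ, A P = smoothFS P (R P))
    (hJ : ∀ h ∈ Finset.Icc 1 t, ∀ ε : ℝ, 0 < ε → ∃ C : ℝ, ∀ P : ℝ, 1 ≤ P →
      JA t ν k (A P) (u h) h ≤ C * P ^ ((2 * u h : ℝ) - (Ksum t ν k h : ℝ) + ε)) :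
    ∀ ε : ℝ, 0 < ε → ∃ C : ℝ, ∀ P : ℝ, 1 ≤ P →
      ‖Iint t ν μ k s c (A P) B‖ ≤
        C * P ^ ((2 * ∑ h ∈ Finset.Icc 1 t, (mu1 t μ h - mu1 t μ (h + 1)) * u h : ℝ)
          - (Ktot t ν μ k : ℝ) + ε) := by
  obtain ⟨-, -, -, hμ, -, -⟩ := hgrp
  intro ε hε
  let β := blockIdx t μ
  let lev : β → ℕ := fun b => b.1.1
  let D : β → Finset (Fin s) := fun b => B (b.1.1, b.1.2)
  have hmem : ∀ b : β, b.1.1 ∈ Finset.Icc 1 t ∧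
      b.1.2 ∈ Finset.Icc 1 (mu1 t μ b.1.1 - mu1 t μ (b.1.1 + 1)) :=
    fun b => Finset.mem_sigma.1 b.2
  set δ : ℝ := ε / (Fintype.card β + 1) with hδ
  have hδ0 : 0 < δ := by positivity
  choose C hC using fun b : β => hJ b.1.1 (hmem b).1 δ hδ0
  have hexp : ∑ b : β, ((2 * u b.1.1 : ℝ) - (Ksum t ν k b.1.1 : ℝ) + δ)
      ≤ (2 * ∑ h ∈ Finset.Icc 1 t, (mu1 t μ h - mu1 t μ (h + 1)) * u h : ℝ)
          - (Ktot t ν μ k : ℝ) + ε := by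
    rw [Finset.sum_add_distrib, Finset.sum_sub_distrib, ← Nat.cast_sum,
      sum_blockIdx_Ksum hμ ν k, sum_blockIdx fun h => (2 * u h : ℝ)]
    have h1 : ∑ h ∈ Finset.Icc 1 t, (mu1 t μ h - mu1 t μ (h + 1)) • (2 * u h : ℝ)
        = 2 * ((∑ h ∈ Finset.Icc 1 t, (mu1 t μ h - mu1 t μ (h + 1)) * u h : ℕ) : ℝ) := by
      rw [Nat.cast_sum, Finset.mul_sum]
      refine Finset.sum_congr rfl fun h hh => ?_
      rw [nsmul_eq_mul, Nat.cast_mul]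
      ring
    have h2 : ∑ _b : β, δ ≤ ε := by
      rw [Finset.sum_const, nsmul_eq_mul, Finset.card_univ, hδ, mul_div_assoc',
        div_le_iff₀ (by positivity)]
      nlinarith
    rw [h1]
    linarith
  have hC0 : ∀ b, 0 ≤ C b := fun b => by
    simpa using (JA_nonneg _ _ _).trans (hC b 1 le_rfl)
  refine ⟨(∏ b : β, (2 * u b.1.1) : ℕ) * ∏ b, C b, fun P hP => ?_⟩
  have hI : Iint t ν μ k s c (A P) B
      = ∫ α in unitBox (EqIdx t ν μ), ∏ b : β, ∏ i ∈ D b, fj t ν μ k s c (A P) α i := by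
    unfold Iint
    refine integral_congr_ae (Eventually.of_forall fun α => ?_)
    simp only [D]
    rw [Finset.prod_coe_sort (blockIdx t μ)
      fun b => ∏ i ∈ B (b.1, b.2), fj t ν μ k s c (A P) α i, Finset.prod_sigma]
  rw [hI]
  refine (norm_integral_prod_fj_le hns (fun b : β => u b.1.1) lev (fun b => hu _ (hmem b).1) D
    (fun b => hBcard _ (hmem b).1 _ (hmem b).2) (fun b b' hne => ?_)
    (card_blockIdx_lt hμ) (A P)).trans ?_
  · refine hBdisj _ (hmem b).1 _ (hmem b).2 _ (hmem b').1 _ (hmem b').2 fun h => hne ?_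
    obtain ⟨h1, h2⟩ := Prod.mk.inj h
    exact Subtype.ext (Sigma.ext h1 (heq_of_eq h2))
  · rw [mul_assoc]
    refine mul_le_mul_of_nonneg_left ?_ (Nat.cast_nonneg _)
    calc ∏ b : β, JA t ν k (A P) (u b.1.1) (lev b)
        ≤ ∏ b : β, C b * P ^ ((2 * u b.1.1 : ℝ) - (Ksum t ν k b.1.1 : ℝ) + δ) :=
          Finset.prod_le_prod (fun b _ => JA_nonneg _ _ _) fun b _ => hC b P hP
      _ = (∏ b, C b) * P ^ ∑ b : β, ((2 * u b.1.1 : ℝ) - (Ksum t ν k b.1.1 : ℝ) + δ) := by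
          rw [Finset.prod_mul_distrib, Real.rpow_sum_of_pos (by linarith)]
      _ ≤ _ := mul_le_mul_of_nonneg_left (Real.rpow_le_rpow_of_exponent_le hP hexp)
          (Finset.prod_nonneg fun b _ => hC0 b)

end
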